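/- Let N ≥ 2, let κ, ω be real constants, let b_1,…,b_N be real parameters, fix an index i, and work on the open subset of ℝ^{2N} where every q_l ≠ 0 and 1 + κ𝐪² > 0. Define the Beltrami Smorodinsky–Winternitz Hamiltonian H^B = ½ (1 + κ𝐪²)( 𝐩² + κ(𝐪·𝐩)² ) + ω² 𝐪² + Σ_{l=1}^N b_l (1 + κ𝐪²)/(2 q_l²) and the function I_i^B = ( p_i + κ(𝐪·𝐩) q_i )² + 2 ω² q_i² + b_i/q_i². Then {I_i^B, H^B} = 0 with respect to the canonical Poisson bracket. -/

import Mathlib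

open scoped BigOperators
open Real

noncomputable section

/-- Phase space ℝ^{2N} with canonical coordinates (q, p). -/
abbrev Phase (N : ℕ) : Type := (Fin N → ℝ) × (Fin N → ℝ)

/-- The canonical Poisson bracket
`{f,g} = ∑ i, (∂f/∂q_i · ∂g/∂p_i − ∂g/∂q_i · ∂f/∂p_i)`. -/
noncomputable def pb {N : ℕ} (f g : Phase N → ℝ) (x : Phase N) : ℝ :=
  ∑ i : Fin N,
    ((fderiv ℝ f x) (Pi.single i 1, 0) * (fderiv ℝ g x) (0, Pi.single i 1)
      - (fderiv ℝ g x) (Pi.single i 1, 0) * (fderiv ℝ f x) (0, Pi.single i 1))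

/-- `𝐪² = Σ q_l²`. -/
noncomputable def qq (N : ℕ) : Phase N → ℝ := fun x => ∑ l : Fin N, (x.1 l) ^ 2

/-- `𝐩² = Σ p_l²`. -/
noncomputable def pp (N : ℕ) : Phase N → ℝ := fun x => ∑ l : Fin N, (x.2 l) ^ 2

/-- `𝐪·𝐩 = Σ q_l p_l`. -/
noncomputable def qp (N : ℕ) : Phase N → ℝ := fun x => ∑ l : Fin N, x.1 l * x.2 l

/-- The Beltrami Smorodinsky–Winternitz Hamiltonian
`H^B = ½(1+κ𝐪²)(𝐩² + κ(𝐪·𝐩)²) + ω²𝐪² + Σ_l b_l (1+κ𝐪²)/(2q_l²)`. -/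
noncomputable def HSW (N : ℕ) (κ ω : ℝ) (b : Fin N → ℝ) : Phase N → ℝ := fun x =>
  1 / 2 * (1 + κ * qq N x) * (pp N x + κ * (qp N x) ^ 2)
    + ω ^ 2 * qq N x
    + ∑ l : Fin N, b l * (1 + κ * qq N x) / (2 * (x.1 l) ^ 2)

/-- The extra integral `I_i^B = (p_i + κ(𝐪·𝐩)q_i)² + 2ω²q_i² + b_i/q_i²`. -/
noncomputable def ISW (N : ℕ) (κ ω : ℝ) (b : Fin N → ℝ) (i : Fin N) :
    Phase N → ℝ := fun x =>
  (x.2 i + κ * qp N x * x.1 i) ^ 2 + 2 * ω ^ 2 * (x.1 i) ^ 2 + b i / (x.1 i) ^ 2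

section Derivatives

variable {N : ℕ} (x : Phase N)

/-- The differential of the coordinate `q_l`. -/
def dq (l : Fin N) : Phase N →L[ℝ] ℝ :=
  (ContinuousLinearMap.proj l).comp (ContinuousLinearMap.fst ℝ (Fin N → ℝ) (Fin N → ℝ))

/-- The differential of the coordinate `p_l`. -/
def dp (l : Fin N) : Phase N →L[ℝ] ℝ :=
  (ContinuousLinearMap.proj l).comp (ContinuousLinearMap.snd ℝ (Fin N → ℝ) (Fin N → ℝ))

@[simp] lemma dq_apply (l : Fin N) (v : Phase N) : dq l v = v.1 l := rfl

@[simp] lemma dp_apply (l : Fin N) (v : Phase N) : dp l v = v.2 l := rfl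

lemma hasFDerivAt_q (l : Fin N) : HasFDerivAt (fun y : Phase N => y.1 l) (dq l) x :=
  (dq l).hasFDerivAt

lemma hasFDerivAt_p (l : Fin N) : HasFDerivAt (fun y : Phase N => y.2 l) (dp l) x :=
  (dp l).hasFDerivAt

lemma hasFDerivAt_qq : HasFDerivAt (qq N) (∑ l, (2 * x.1 l) • dq l) x := by
  refine HasFDerivAt.fun_sum fun l _ => ?_
  simpa using (hasFDerivAt_q x l).pow 2

lemma hasFDerivAt_pp : HasFDerivAt (pp N) (∑ l, (2 * x.2 l) • dp l) x := by
  refine HasFDerivAt.fun_sum fun l _ => ?_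
  simpa using (hasFDerivAt_p x l).pow 2

lemma hasFDerivAt_qp : HasFDerivAt (qp N) (∑ l, (x.1 l • dp l + x.2 l • dq l)) x :=
  HasFDerivAt.fun_sum fun l _ => (hasFDerivAt_q x l).mul (hasFDerivAt_p x l)

lemma hasFDerivAt_div_q_sq (c : ℝ) (l : Fin N) (hl : x.1 l ≠ 0) :
    HasFDerivAt (fun y : Phase N => c / (y.1 l) ^ 2) ((-2 * c / (x.1 l) ^ 3) • dq l) x := by
  have h : HasDerivAt (fun t : ℝ => c / t ^ 2) (-2 * c / (x.1 l) ^ 3) (x.1 l) :=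
    ((hasDerivAt_const (x.1 l) c).fun_div (hasDerivAt_pow 2 (x.1 l))
      (pow_ne_zero 2 hl)).congr_deriv (by field_simp; ring)
  exact HasDerivAt.comp_hasFDerivAt (f := fun y : Phase N => y.1 l) x h (hasFDerivAt_q x l)

/-- The flat centrifugal potential `Σ_l b_l / q_l²`, twice the usual normalization. -/
def centrifugal (b : Fin N → ℝ) : Phase N → ℝ := fun y => ∑ l, b l / (y.1 l) ^ 2

lemma hasFDerivAt_centrifugal (b : Fin N → ℝ) (hx : ∀ l, x.1 l ≠ 0) :
    HasFDerivAt (centrifugal b) (∑ l, (-2 * b l / (x.1 l) ^ 3) • dq l) x :=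
  HasFDerivAt.fun_sum fun l _ => hasFDerivAt_div_q_sq x (b l) l (hx l)

lemma HSW_eq (κ ω : ℝ) (b : Fin N → ℝ) :
    HSW N κ ω b = fun y => 1 / 2 * (1 + κ * qq N y) * (pp N y + κ * (qp N y) ^ 2)
      + ω ^ 2 * qq N y + 1 / 2 * (1 + κ * qq N y) * centrifugal b y := by
  funext y
  simp only [HSW, centrifugal, Finset.mul_sum]
  congr 1
  refine Finset.sum_congr rfl fun l _ => ?_
  rw [mul_comm (2 : ℝ), ← div_div]
  ring

lemma fderiv_HSW_apply (κ ω : ℝ) (b : Fin N → ℝ) (hx : ∀ l, x.1 l ≠ 0) (v : Phase N) :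
    fderiv ℝ (HSW N κ ω b) x v =
      1 / 2 * κ * (∑ l, 2 * x.1 l * v.1 l)
          * (pp N x + κ * (qp N x) ^ 2 + centrifugal b x)
        + 1 / 2 * (1 + κ * qq N x) * ((∑ l, 2 * x.2 l * v.2 l)
          + 2 * κ * qp N x * (∑ l, (x.1 l * v.2 l + x.2 l * v.1 l))
          + ∑ l, -2 * b l / (x.1 l) ^ 3 * v.1 l)
        + ω ^ 2 * ∑ l, 2 * x.1 l * v.1 l := by
  have hA := (((hasFDerivAt_qq x).const_mul κ).const_add 1).const_mul (1 / 2)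
  have hK := (hasFDerivAt_pp x).fun_add (((hasFDerivAt_qp x).pow 2).const_mul κ)
  have hH := ((hA.fun_mul hK).fun_add ((hasFDerivAt_qq x).const_mul (ω ^ 2))).fun_add
    (hA.fun_mul (hasFDerivAt_centrifugal x b hx))
  rw [HSW_eq, HasFDerivAt.fderiv hH]
  simp
  ring

lemma fderiv_ISW_apply (κ ω : ℝ) (b : Fin N → ℝ) (i : Fin N) (hi : x.1 i ≠ 0) (v : Phase N) :
    fderiv ℝ (ISW N κ ω b i) x v =
      2 * (x.2 i + κ * qp N x * x.1 i)
          * (v.2 i + κ * (∑ l, (x.1 l * v.2 l + x.2 l * v.1 l)) * x.1 i + κ * qp N x * v.1 i)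
        + 4 * ω ^ 2 * x.1 i * v.1 i - 2 * b i / (x.1 i) ^ 3 * v.1 i := by
  have hu := (hasFDerivAt_p x i).fun_add (((hasFDerivAt_qp x).const_mul κ).fun_mul (hasFDerivAt_q x i))
  have hI := ((hu.pow 2).fun_add (((hasFDerivAt_q x i).pow 2).const_mul (2 * ω ^ 2))).fun_add
    (hasFDerivAt_div_q_sq x (b i) i hi)
  unfold ISW
  rw [HasFDerivAt.fderiv hI]
  simp
  ring

end Derivatives

/-- `{I_i^B, H^B} = 0` on the open set where every `q_l ≠ 0` and
`1 + κ𝐪² > 0`. -/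
theorem ISW_commutes_with_HSW (N : ℕ) (hN : 2 ≤ N) (κ ω : ℝ)
    (b : Fin N → ℝ) (i : Fin N)
    (x : Phase N) (hx : ∀ l, x.1 l ≠ 0) (hκ : 1 + κ * qq N x > 0) :
    pb (ISW N κ ω b i) (HSW N κ ω b) x = 0 := by
  set s := qp N x with hs
  set Q := qq N x with hQ
  set P := pp N x with hP
  set C := centrifugal b x with hC
  set u := x.2 i + κ * s * x.1 i with hu
  have summand (k : Fin N) :
      fderiv ℝ (ISW N κ ω b i) x (Pi.single k 1, 0) * fderiv ℝ (HSW N κ ω b) x (0, Pi.single k 1)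
        - fderiv ℝ (HSW N κ ω b) x (Pi.single k 1, 0)
          * fderiv ℝ (ISW N κ ω b i) x (0, Pi.single k 1) =
      2 * u * κ * x.1 i * (1 + κ * Q) * (x.2 k) ^ 2
        - 2 * u * κ * x.1 i * (κ * (P + κ * s ^ 2 + C) + 2 * ω ^ 2) * (x.1 k) ^ 2
        + 2 * u * κ * x.1 i * (1 + κ * Q) * (b k / (x.1 k) ^ 2)
        + if k = i then
            (2 * u * κ * s + 4 * ω ^ 2 * x.1 i - 2 * b i / (x.1 i) ^ 3) * ((1 + κ * Q) * u)
              - 2 * u * (κ * x.1 i * (P + κ * s ^ 2 + C) + (1 + κ * Q) * κ * s * x.2 i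
                + 2 * ω ^ 2 * x.1 i - (1 + κ * Q) * b i / (x.1 i) ^ 3)
          else 0 := by
    have hk := hx k
    simp only [fderiv_HSW_apply x κ ω b hx, fderiv_ISW_apply x κ ω b i (hx i),
      ← hs, ← hQ, ← hP, ← hC, ← hu]
    by_cases h : k = i
    · subst h
      simp [Pi.single_apply]
      rw [hu]
      field_simp
      ring
    · simp [Pi.single_apply, h, Ne.symm h]
      field_simp
      ring
  unfold pb
  simp only [summand, Finset.sum_add_distrib, Finset.sum_sub_distrib, ← Finset.mul_sum,
    Finset.sum_ite_eq', Finset.mem_univ, if_true]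
  change 2 * u * κ * x.1 i * (1 + κ * Q) * P
    - 2 * u * κ * x.1 i * (κ * (P + κ * s ^ 2 + C) + 2 * ω ^ 2) * Q
    + 2 * u * κ * x.1 i * (1 + κ * Q) * C + _ = 0
  rw [hu]
  ring
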